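/- Let S and T be finite sets of positive integers with T ⪯ S, and let x ∈ T be such that T − x ⪯ S. Then for all 1 ≤ i ≤ |S|, (T ◁ S)(i) ≥ ((T − x) ◁ S)(i). -/

import Mathlib

/-- The `◁` operator: `tri T S = T ◁ S`.  Iterate through the elements of `S` from
largest to smallest; the current element `s` picks the largest element of `T` that is
less than `s` and has not yet been picked (if such an element exists), and the picked
elements form `T ◁ S`. -/
def tri (T S : Finset ℕ) : Finset ℕ :=
  if hS : S.Nonempty then
    if hT : (T.filter (fun t => t < S.max' hS)).Nonempty then
      insert ((T.filter (fun t => t < S.max' hS)).max' hT)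
        (tri (T.filter (fun t => t < (T.filter (fun t => t < S.max' hS)).max' hT))
          (S.erase (S.max' hS)))
    else ∅
  else ∅
termination_by S.card
decreasing_by
  exact Finset.card_erase_lt_of_mem (S.max'_mem hS)

/-- `nth S i` is the `i`-th smallest element of `S` (1-based), i.e. `S(i)`. -/
def nth (S : Finset ℕ) (i : ℕ) : ℕ :=
  (S.sort (· ≤ ·)).getD (i - 1) 0

/-- `Dom T S` means `T ⪯ S`, i.e. `S` dominates `T`:
`|T| ≥ |S|` and `T(i) < S(i)` for all `1 ≤ i ≤ |S|`. -/
def Dom (T S : Finset ℕ) : Prop :=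
  S.card ≤ T.card ∧ ∀ i, 1 ≤ i → i ≤ S.card → nth T i < nth S i

theorem tri_subset (n : ℕ) : ∀ S T : Finset ℕ, S.card = n → tri T S ⊆ T := by
  induction n with
  | zero =>
    intro S T h
    rw [Finset.card_eq_zero] at h
    subst h
    rw [tri]; simp
  | succ n ih =>
    intro S T h
    rw [tri]
    split_ifs with hS hT
    · have h1 := Finset.max'_mem _ hT
      have h2 := ih (S.erase (S.max' hS))
        (T.filter (fun t => t < (T.filter (fun t => t < S.max' hS)).max' hT))
        (by rw [Finset.card_erase_of_mem (S.max'_mem hS)]; omega)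
      apply Finset.insert_subset
      · exact (Finset.mem_filter.1 h1).1
      · exact h2.trans (Finset.filter_subset _ _)
    · simp
    · simp

theorem tri_step (S T : Finset ℕ) (hS : S.Nonempty) (q : ℕ) (hq : q ∈ T) (hqs : q < S.max' hS)
    (hmax : ∀ t ∈ T, t < S.max' hS → t ≤ q) :
    tri T S = insert q (tri (T.filter (fun t => t < q)) (S.erase (S.max' hS))) := by
  have hT : (T.filter (fun t => t < S.max' hS)).Nonempty := ⟨q, by simp [hq, hqs]⟩
  have e : (T.filter (fun t => t < S.max' hS)).max' hT = q := by
    apply le_antisymm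
    · apply Finset.max'_le
      intro y hy
      rw [Finset.mem_filter] at hy
      exact hmax y hy.1 hy.2
    · apply Finset.le_max'
      simp [hq, hqs]
  rw [tri, dif_pos hS, dif_pos hT, e]

theorem tri_cases (S T : Finset ℕ) (hS : S.Nonempty) :
    (tri T S = ∅ ∧ ∀ t ∈ T, ¬ t < S.max' hS) ∨
    ∃ q ∈ T, q < S.max' hS ∧ (∀ t ∈ T, t < S.max' hS → t ≤ q) := by
  by_cases hT : (T.filter (fun t => t < S.max' hS)).Nonempty
  · right
    have h1 := Finset.mem_filter.1 (Finset.max'_mem _ hT)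
    refine ⟨_, h1.1, h1.2, fun t ht hts => Finset.le_max' _ _ (by simp [ht, hts])⟩
  · left
    refine ⟨by rw [tri, dif_pos hS, dif_neg hT], fun t ht hts => hT ⟨t, by simp [ht, hts]⟩⟩

theorem tri_lt (S T : Finset ℕ) (q y : ℕ) (hy : y ∈ tri (T.filter (fun t => t < q)) S) : y < q :=
  (Finset.mem_filter.1 (tri_subset _ _ _ rfl hy)).2

theorem tri_card_le (n : ℕ) : ∀ S T : Finset ℕ, S.card = n → (tri T S).card ≤ n := by
  induction n with
  | zero =>
    intro S T h
    rw [Finset.card_eq_zero] at h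
    subst h
    rw [tri]; simp
  | succ n ih =>
    intro S T h
    have hS : S.Nonempty := Finset.card_pos.1 (by omega)
    rcases tri_cases S T hS with ⟨h0, -⟩ | ⟨q, hq, hqs, hm⟩
    · simp [h0]
    · rw [tri_step S T hS q hq hqs hm]
      refine (Finset.card_insert_le _ _).trans ?_
      have := ih (S.erase (S.max' hS)) (T.filter (fun t => t < q))
        (by rw [Finset.card_erase_of_mem (S.max'_mem hS)]; omega)
      omega

theorem tri_mono (n : ℕ) : ∀ S A B : Finset ℕ, S.card = n → A ⊆ B → ∀ m,
    ((tri A S).filter (fun t => m ≤ t)).card ≤ ((tri B S).filter (fun t => m ≤ t)).card := by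
  induction n with
  | zero =>
    intro S A B h
    rw [Finset.card_eq_zero] at h
    subst h
    intro _ m
    rw [tri]; simp
  | succ n ih =>
    intro S A B h hAB m
    have hS : S.Nonempty := Finset.card_pos.1 (by omega)
    rcases tri_cases S A hS with ⟨h0, -⟩ | ⟨q, hq, hqs, hqm⟩
    · simp [h0]
    rcases tri_cases S B hS with ⟨h0, h1⟩ | ⟨p, hp, hps, hpm⟩
    · exact absurd hqs (h1 q (hAB hq))
    have hqp : q ≤ p := hpm q (hAB hq) hqs
    rw [tri_step S A hS q hq hqs hqm, tri_step S B hS p hp hps hpm]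
    have key := ih (S.erase (S.max' hS)) (A.filter (fun t => t < q)) (B.filter (fun t => t < p))
        (by rw [Finset.card_erase_of_mem (S.max'_mem hS)]; omega)
        (by
          intro t ht
          rw [Finset.mem_filter] at ht ⊢
          exact ⟨hAB ht.1, by omega⟩) m
    by_cases hmq : m ≤ q
    · rw [Finset.filter_insert, Finset.filter_insert, if_pos hmq, if_pos (hmq.trans hqp),
        Finset.card_insert_of_notMem, Finset.card_insert_of_notMem]
      · omega
      · intro h'
        exact absurd (tri_lt _ _ _ _ (Finset.mem_filter.1 h').1) (lt_irrefl _)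
      · intro h'
        exact absurd (tri_lt _ _ _ _ (Finset.mem_filter.1 h').1) (lt_irrefl _)
    · rw [Finset.filter_eq_empty_iff.2]
      · simp
      · intro t ht
        rw [Finset.mem_insert] at ht
        rcases ht with rfl | ht
        · exact hmq
        · have := tri_lt _ _ _ _ ht
          omega

theorem tri_card (n : ℕ) : ∀ S A : Finset ℕ, S.card = n →
    (∀ s ∈ S, (S.filter (fun t => t ≤ s)).card ≤ (A.filter (fun t => t < s)).card) →
    (tri A S).card = n := by
  induction n with
  | zero =>
    intro S A h _
    have := tri_card_le 0 S A h
    omega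
  | succ n ih =>
    intro S A h hC
    have hS : S.Nonempty := Finset.card_pos.1 (by omega)
    have h1 := hC _ (S.max'_mem hS)
    rw [Finset.filter_true_of_mem (fun t ht => S.le_max' t ht)] at h1
    rcases tri_cases S A hS with ⟨-, h0⟩ | ⟨q, hq, hqs, hqm⟩
    · rw [Finset.filter_false_of_mem h0] at h1
      rw [Finset.card_empty] at h1; omega
    rw [tri_step S A hS q hq hqs hqm, Finset.card_insert_of_notMem
      (fun h' => absurd (tri_lt _ _ _ _ h') (lt_irrefl _))]
    have hc : (S.erase (S.max' hS)).card = n := by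
      rw [Finset.card_erase_of_mem (S.max'_mem hS)]; omega
    have hA : A.filter (fun t => t < S.max' hS) = insert q (A.filter (fun t => t < q)) := by
      ext t
      simp only [Finset.mem_filter, Finset.mem_insert]
      constructor
      · rintro ⟨a, b⟩
        have := hqm t a b
        rcases this.eq_or_lt with e | e
        · exact Or.inl e
        · exact Or.inr ⟨a, e⟩
      · rintro (rfl | ⟨a, b⟩)
        · exact ⟨hq, hqs⟩
        · exact ⟨a, b.trans hqs⟩
    rw [hA, Finset.card_insert_of_notMem (by simp)] at h1
    rw [ih _ _ hc]
    intro s hs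
    by_cases hsq : s ≤ q
    · refine le_trans (Finset.card_le_card (Finset.filter_subset_filter _ (Finset.erase_subset _ _)))
        ((hC s (Finset.mem_of_mem_erase hs)).trans (Finset.card_le_card ?_))
      intro t ht
      simp only [Finset.mem_filter] at ht ⊢
      exact ⟨⟨ht.1, by omega⟩, ht.2⟩
    · refine (Finset.card_le_card (Finset.filter_subset _ _)).trans ?_
      rw [Finset.filter_true_of_mem (s := A.filter (fun t => t < q))]
      · omega
      · intro t ht
        have := (Finset.mem_filter.1 ht).2
        omega

theorem nth_eq (S : Finset ℕ) (i : Fin S.card) : nth S (i + 1) = S.orderEmbOfFin rfl i := by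
  rw [Finset.orderEmbOfFin_apply]
  unfold nth
  simp [List.getD_eq_getElem]

theorem card_le_nth (S : Finset ℕ) (i : Fin S.card) :
    (S.filter (fun t => t ≤ nth S (i + 1))).card = i + 1 := by
  have : S.filter (fun t => t ≤ nth S (i + 1))
      = (Finset.Iic i).map (S.orderEmbOfFin rfl).toEmbedding := by
    ext t
    simp only [Finset.mem_filter, Finset.mem_map, Finset.mem_Iic, nth_eq]
    constructor
    · rintro ⟨a, b⟩
      have : t ∈ Set.range (S.orderEmbOfFin rfl) := by
        rw [Finset.range_orderEmbOfFin]; exact a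
      obtain ⟨j, rfl⟩ := this
      exact ⟨j, (S.orderEmbOfFin rfl).le_iff_le.1 b, rfl⟩
    · rintro ⟨j, hj, rfl⟩
      exact ⟨Finset.orderEmbOfFin_mem _ _ _, (S.orderEmbOfFin rfl).le_iff_le.2 hj⟩
  rw [this, Finset.card_map, Fin.card_Iic]

theorem nth_mem' (S : Finset ℕ) (i : Fin S.card) : nth S (i + 1) ∈ S := by
  rw [nth_eq]; exact Finset.orderEmbOfFin_mem _ _ _

theorem dom_count (T S : Finset ℕ) (h : Dom T S) (s : ℕ) (hs : s ∈ S) :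
    (S.filter (fun t => t ≤ s)).card ≤ (T.filter (fun t => t < s)).card := by
  have : s ∈ Set.range (S.orderEmbOfFin rfl) := by
    rw [Finset.range_orderEmbOfFin]; exact hs
  obtain ⟨j, rfl⟩ := this
  rw [← nth_eq, card_le_nth]
  have h2 := h.2 (j + 1) (by omega) (by omega)
  have h3 := card_le_nth T ⟨j, by have := h.1; omega⟩
  simp only at h3
  refine h3.ge.trans (Finset.card_le_card ?_)
  intro t ht
  simp only [Finset.mem_filter] at ht ⊢
  exact ⟨ht.1, by omega⟩

theorem nth_le_of_count (A B : Finset ℕ) (hc : A.card = B.card)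
    (h : ∀ m, (A.filter (fun t => m ≤ t)).card ≤ (B.filter (fun t => m ≤ t)).card)
    (i : ℕ) (hi : i < A.card) : nth A (i + 1) ≤ nth B (i + 1) := by
  by_contra hlt
  push Not at hlt
  have hA := card_le_nth A ⟨i, hi⟩
  have hB := card_le_nth B ⟨i, by omega⟩
  have hm := nth_mem' A ⟨i, hi⟩
  simp only at hA hB hm
  have h1 := h (nth A (i + 1))
  have e1 : (A.filter (fun t => t ≤ nth A (i+1))).card + (A.filter (fun t => nth A (i+1) ≤ t)).card
      ≥ A.card + 1 := by
    rw [← Finset.card_union_add_card_inter]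
    have a1 : A ⊆ A.filter (fun t => t ≤ nth A (i+1)) ∪ A.filter (fun t => nth A (i+1) ≤ t) := by
      intro t ht
      simp only [Finset.mem_union, Finset.mem_filter]
      rcases le_total t (nth A (i+1)) with h | h
      · exact Or.inl ⟨ht, h⟩
      · exact Or.inr ⟨ht, h⟩
    have a2 : 0 < (A.filter (fun t => t ≤ nth A (i+1)) ∩
        A.filter (fun t => nth A (i+1) ≤ t)).card :=
      Finset.card_pos.2 ⟨nth A (i+1), by simp [hm]⟩
    have := Finset.card_le_card a1
    omega
  have e2 : (B.filter (fun t => t ≤ nth B (i+1))).card + (B.filter (fun t => nth A (i+1) ≤ t)).card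
      ≤ B.card := by
    rw [← Finset.card_union_of_disjoint]
    · exact Finset.card_le_card (Finset.union_subset (Finset.filter_subset _ _)
        (Finset.filter_subset _ _))
    · rw [Finset.disjoint_left]
      intro t h1 h2
      simp only [Finset.mem_filter] at h1 h2
      omega
  omega

theorem stmt7 (S T : Finset ℕ) (hSpos : ∀ a ∈ S, 0 < a) (hTpos : ∀ a ∈ T, 0 < a)
    (hd : Dom T S) (x : ℕ) (hxT : x ∈ T) (hd' : Dom (T.erase x) S) :
    ∀ i, 1 ≤ i → i ≤ S.card → nth (tri (T.erase x) S) i ≤ nth (tri T S) i := by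
  intro i h1 h2
  have hA := tri_card _ S _ rfl (dom_count _ _ hd')
  have hB := tri_card _ S _ rfl (dom_count _ _ hd)
  obtain ⟨j, rfl⟩ : ∃ j, i = j + 1 := ⟨i - 1, by omega⟩
  exact nth_le_of_count _ _ (hA.trans hB.symm)
    (tri_mono _ S _ _ rfl (Finset.erase_subset _ _)) j (by omega)
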